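/- arXiv:1701.06317 — 3 statements merged into one kernel-verified Lean document; each statement's English description precedes it below -/
import Mathlib

section
/- Let 1 ≤ l̃ ≤ l ≤ m+1 and let q̃ ∈ Q minimize zBS^{l̃} over Q. If q̃ contains none of the elements e_1, …, e_{l−1}, then q̃ minimizes zBS^l over Q. -/
open Finset

/-- The cardinality-constrained uncertainty set: all cost functions `c` with
`n e ≤ c e ≤ n e + δ e` for every element, and at most `Γ` elements with `c e > n e`. -/
def Uset {E : Type*} [Fintype E] [DecidableEq E] (n δ : E → ℝ) (Γ : ℕ) : Set (E → ℝ) :=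
  {c | (∀ e, n e ≤ c e ∧ c e ≤ n e + δ e) ∧
    (Finset.univ.filter fun e => n e < c e).card ≤ Γ}

/-- The worst-case cost `zRC(q) = max_{c ∈ U} ∑_{e ∈ q} c e`. -/
noncomputable def zRC {E : Type*} [Fintype E] [DecidableEq E] (n δ : E → ℝ) (Γ : ℕ)
    (q : Finset E) : ℝ :=
  sSup {x : ℝ | ∃ c ∈ Uset n δ Γ, x = ∑ e ∈ q, c e}

/-- `δ̄_l` for `l ∈ {1,…,m}` (1-based), and `δ̄_{m+1} = 0`, where the enumeration
`e : Fin m ≃ E` lists the elements in order of decreasing interval length. -/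
noncomputable def dbar {E : Type*} [Fintype E] (δ : E → ℝ)
    (e : Fin (Fintype.card E) ≃ E) (l : ℕ) : ℝ :=
  if h : l - 1 < Fintype.card E then δ (e ⟨l - 1, h⟩) else 0

/-- The subproblem objective
`zBS^l(q) = ∑_{e∈q} n e + Γ·δ̄_l + ∑_{e_j ∈ q, j ≤ l} (δ_{e_j} − δ̄_l)`,
where `e_j` has 1-based index `j`, i.e. `j = (e.symm x : ℕ) + 1`. -/
noncomputable def zBS {E : Type*} [Fintype E] [DecidableEq E] (n δ : E → ℝ) (Γ : ℕ)
    (e : Fin (Fintype.card E) ≃ E) (l : ℕ) (q : Finset E) : ℝ :=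
  (∑ x ∈ q, n x) + Γ * dbar δ e l +
    ∑ x ∈ q.filter (fun x => ((e.symm x : ℕ) + 1 ≤ l)), (δ x - dbar δ e l)

/-- The sorted interval lengths dominate `dbar` at every later index. -/
lemma dbar_le_of_index_le {E : Type*} [Fintype E] {δ : E → ℝ} (hδ : ∀ x, 0 ≤ δ x)
    {e : Fin (Fintype.card E) ≃ E}
    (hsort : ∀ i j : Fin (Fintype.card E), i ≤ j → δ (e j) ≤ δ (e i))
    {l : ℕ} {x : E} (hx : (e.symm x : ℕ) + 1 ≤ l) : dbar δ e l ≤ δ x := by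
  unfold dbar
  split_ifs with h
  · have := hsort (e.symm x) ⟨l - 1, h⟩ (Fin.le_def.2 (by simp only; omega))
    rwa [e.apply_symm_apply] at this
  · exact hδ x

lemma dbar_symm_succ {E : Type*} [Fintype E] (δ : E → ℝ) (e : Fin (Fintype.card E) ≃ E)
    (x : E) : dbar δ e ((e.symm x : ℕ) + 1) = δ x := by
  simp [dbar]

/-- `dbar` is antitone on positive indices. -/
lemma dbar_le_dbar {E : Type*} [Fintype E] {δ : E → ℝ} (hδ : ∀ x, 0 ≤ δ x)
    {e : Fin (Fintype.card E) ≃ E}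
    (hsort : ∀ i j : Fin (Fintype.card E), i ≤ j → δ (e j) ≤ δ (e i))
    {k l : ℕ} (hk : 1 ≤ k) (hkl : k ≤ l) : dbar δ e l ≤ dbar δ e k := by
  by_cases h : k - 1 < Fintype.card E
  · have hle : dbar δ e l ≤ δ (e ⟨k - 1, h⟩) :=
      dbar_le_of_index_le hδ hsort (by simp only [Equiv.symm_apply_apply]; omega)
    simpa only [dbar, dif_pos h] using hle
  · have h' : ¬ l - 1 < Fintype.card E := by omega
    simp only [dbar, dif_neg h, dif_neg h', le_refl]

/-- The deviation term of `zBS` vanishes on sets avoiding all earlier elements. -/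
lemma zBS_eq_of_forall_notMem {E : Type*} [Fintype E] [DecidableEq E] (n δ : E → ℝ) (Γ : ℕ)
    {e : Fin (Fintype.card E) ≃ E} {l : ℕ} {q : Finset E}
    (hq : ∀ j : Fin (Fintype.card E), (j : ℕ) + 1 ≤ l - 1 → e j ∉ q) :
    zBS n δ Γ e l q = (∑ x ∈ q, n x) + Γ * dbar δ e l := by
  rw [zBS, add_eq_left]
  refine Finset.sum_eq_zero fun x hx => ?_
  rw [Finset.mem_filter] at hx
  have hl : l = (e.symm x : ℕ) + 1 := by
    by_contra hne
    exact hq (e.symm x) (by omega) (by simpa using hx.1)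
  rw [hl, dbar_symm_succ, sub_self]

/-- The deviation term of `zBS` is monotone in the index. -/
lemma sum_sub_dbar_mono {E : Type*} [Fintype E] {δ : E → ℝ} (hδ : ∀ x, 0 ≤ δ x)
    {e : Fin (Fintype.card E) ≃ E}
    (hsort : ∀ i j : Fin (Fintype.card E), i ≤ j → δ (e j) ≤ δ (e i))
    {k l : ℕ} (hk : 1 ≤ k) (hkl : k ≤ l) (q : Finset E) :
    ∑ x ∈ q.filter (fun x => (e.symm x : ℕ) + 1 ≤ k), (δ x - dbar δ e k) ≤
      ∑ x ∈ q.filter (fun x => (e.symm x : ℕ) + 1 ≤ l), (δ x - dbar δ e l) := by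
  refine (Finset.sum_le_sum fun x _ =>
    sub_le_sub_left (dbar_le_dbar hδ hsort hk hkl) (δ x)).trans ?_
  refine Finset.sum_le_sum_of_subset_of_nonneg
    (Finset.monotone_filter_right q fun x _ hx => hx.trans hkl) fun x hx _ => ?_
  exact sub_nonneg.2 (dbar_le_of_index_le hδ hsort (Finset.mem_filter.1 hx).2)

/-- Let `1 ≤ l̃ ≤ l ≤ m+1` and let `q̃ ∈ Q` minimize `zBS^{l̃}` over `Q`.
If `q̃` contains none of the elements `e_1, …, e_{l−1}` (1-based indices), then `q̃`
minimizes `zBS^l` over `Q`. -/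
theorem stmt6 {E : Type*} [Fintype E] [DecidableEq E] [Nonempty E]
    (Q : Set (Finset E)) (hQ : Q.Nonempty)
    (n δ : E → ℝ) (hδ : ∀ x, 0 ≤ δ x)
    (Γ : ℕ) (hΓ1 : 1 ≤ Γ) (hΓ2 : Γ ≤ Fintype.card E)
    (e : Fin (Fintype.card E) ≃ E)
    (hsort : ∀ i j : Fin (Fintype.card E), i ≤ j → δ (e j) ≤ δ (e i))
    (lt l : ℕ) (h1 : 1 ≤ lt) (h2 : lt ≤ l) (h3 : l ≤ Fintype.card E + 1)
    (qt : Finset E) (hqt : qt ∈ Q)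
    (hmin : ∀ q ∈ Q, zBS n δ Γ e lt qt ≤ zBS n δ Γ e lt q)
    (hnone : ∀ j : Fin (Fintype.card E), (j : ℕ) + 1 ≤ l - 1 → e j ∉ qt) :
    ∀ q ∈ Q, zBS n δ Γ e l qt ≤ zBS n δ Γ e l q := by
  intro q hq
  have hle := hmin q hq
  rw [zBS_eq_of_forall_notMem n δ Γ fun j hj => hnone j (by omega)] at hle
  rw [zBS_eq_of_forall_notMem n δ Γ hnone]
  have hsum := sum_sub_dbar_mono hδ hsort h1 h2 q
  unfold zBS at hle ⊢
  linarith
end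

section
/- Assume objective independent element order. For each l ∈ {1, …, m+1} let Z^l ⊆ Q be a complete set of efficient solutions for the multi-objective problem min_{q∈Q} zBS^l(q), and set Z = ∪_{l=1}^{m+1} Z^l. Then the set S = {q ∈ Z : there is no q′ ∈ Z such that zRC(q′) dominates zRC(q)} is a complete set of robust efficient solutions, i.e., a complete set of efficient solutions for zRC. -/
open Finset

/-- The multi-objective cardinality-constrained uncertainty set: all cost functions `c` with
`n e i ≤ c e i ≤ n e i + δ e i` for all `e, i`, and, for each objective `i`,
at most `Γ i` elements with `c e i > n e i`. -/
def Uk {E : Type*} [Fintype E] [DecidableEq E] {k : ℕ} (n δ : E → Fin k → ℝ)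
    (Γ : Fin k → ℕ) : Set (E → Fin k → ℝ) :=
  {c | (∀ e i, n e i ≤ c e i ∧ c e i ≤ n e i + δ e i) ∧
    ∀ i, (Finset.univ.filter fun e => n e i < c e i).card ≤ Γ i}

/-- The worst-case cost vector: `zRC_i(q) = max_{c ∈ U} ∑_{e ∈ q} c e i`. -/
noncomputable def zRCk {E : Type*} [Fintype E] [DecidableEq E] {k : ℕ}
    (n δ : E → Fin k → ℝ) (Γ : Fin k → ℕ) (q : Finset E) : Fin k → ℝ :=
  fun i => sSup {x : ℝ | ∃ c ∈ Uk n δ Γ, x = ∑ e ∈ q, c e i}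

/-- `δ̄_{l,i}` for `l ∈ {1,…,m}` (1-based), and `δ̄_{m+1} = 0`, where the enumeration
`e : Fin m ≃ E` lists the elements in order of (componentwise) decreasing interval length. -/
noncomputable def dbarK {E : Type*} [Fintype E] {k : ℕ} (δ : E → Fin k → ℝ)
    (e : Fin (Fintype.card E) ≃ E) (l : ℕ) (i : Fin k) : ℝ :=
  if h : l - 1 < Fintype.card E then δ (e ⟨l - 1, h⟩) i else 0

/-- The multi-objective subproblem objective (objective independent element order):
`zBS^l_i(q) = ∑_{e∈q} n e i + Γ_i·δ̄_{l,i} + ∑_{e_j ∈ q, j ≤ l} (δ_{e_j,i} − δ̄_{l,i})`,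
where `e_j` has 1-based index `j = (e.symm x : ℕ) + 1`. -/
noncomputable def zBSk {E : Type*} [Fintype E] [DecidableEq E] {k : ℕ}
    (n δ : E → Fin k → ℝ) (Γ : Fin k → ℕ) (e : Fin (Fintype.card E) ≃ E)
    (l : ℕ) (q : Finset E) : Fin k → ℝ :=
  fun i => (∑ x ∈ q, n x i) + Γ i * dbarK δ e l i +
    ∑ x ∈ q.filter (fun x => ((e.symm x : ℕ) + 1 ≤ l)), (δ x i - dbarK δ e l i)

/-- `y` dominates `y'` if `y_j ≤ y'_j` for all `j` and `y ≠ y'`. -/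
def Dominates {ι : Type*} (y y' : ι → ℝ) : Prop := (∀ j, y j ≤ y' j) ∧ y ≠ y'

/-- `q` is an efficient solution of `min_{q ∈ Q} f(q)`:
`q ∈ Q` and no `q' ∈ Q` has `f q'` dominating `f q`. -/
def Efficient {E ι : Type*} (Q : Set (Finset E)) (f : Finset E → ι → ℝ)
    (q : Finset E) : Prop :=
  q ∈ Q ∧ ∀ q' ∈ Q, ¬ Dominates (f q') (f q)

/-- `G` is a complete set of efficient solutions for `f` on `Q`: `G ⊆ Q`, every member of `G`
is efficient, and every `q ∈ Q` is dominated by, or has the same `f`-value as, a member of `G`. -/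
def CompleteEff {E ι : Type*} (Q : Set (Finset E)) (f : Finset E → ι → ℝ)
    (G : Set (Finset E)) : Prop :=
  G ⊆ Q ∧ (∀ q ∈ G, Efficient Q f q) ∧
    ∀ q ∈ Q, ∃ q' ∈ G, Dominates (f q') (f q) ∨ f q' = f q

section WorstCase

variable {E : Type*} [Fintype E] {k : ℕ} {n δ : E → Fin k → ℝ}
  {Γ : Fin k → ℕ} {e : Fin (Fintype.card E) ≃ E}

lemma dbarK_nonneg (hδ : ∀ x i, 0 ≤ δ x i) (l : ℕ) (i : Fin k) : 0 ≤ dbarK δ e l i := by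
  unfold dbarK
  split_ifs
  · exact hδ _ _
  · exact le_rfl

lemma dbarK_card_add_one (i : Fin k) : dbarK δ e (Fintype.card E + 1) i = 0 := by
  simp [dbarK]

lemma dbarK_le_of_le (hδ : ∀ x i, 0 ≤ δ x i)
    (hsort : ∀ i : Fin k, ∀ a b : Fin (Fintype.card E), a ≤ b → δ (e b) i ≤ δ (e a) i)
    {l : ℕ} {x : E} (hx : (e.symm x : ℕ) + 1 ≤ l) (i : Fin k) : dbarK δ e l i ≤ δ x i := by
  unfold dbarK
  split_ifs with h
  · have hle : e.symm x ≤ ⟨l - 1, h⟩ := by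
      rw [Fin.le_def]
      simp only
      omega
    simpa using hsort i _ _ hle
  · exact hδ _ _

lemma le_dbarK_of_lt
    (hsort : ∀ i : Fin k, ∀ a b : Fin (Fintype.card E), a ≤ b → δ (e b) i ≤ δ (e a) i)
    {l : ℕ} {x : E} (hx : l < (e.symm x : ℕ) + 1) (i : Fin k) : δ x i ≤ dbarK δ e l i := by
  have hlt := (e.symm x).isLt
  have h : l - 1 < Fintype.card E := by omega
  have hle : (⟨l - 1, h⟩ : Fin (Fintype.card E)) ≤ e.symm x := by
    rw [Fin.le_def]
    simp only
    omega
  simpa [dbarK, h] using hsort i _ _ hle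

variable [DecidableEq E]

/-- Every scenario cost of `q` is bounded by every bottleneck-sum objective value of `q`. -/
lemma sum_le_zBSk (hδ : ∀ x i, 0 ≤ δ x i)
    (hsort : ∀ i : Fin k, ∀ a b : Fin (Fintype.card E), a ≤ b → δ (e b) i ≤ δ (e a) i)
    {c : E → Fin k → ℝ} (hc : c ∈ Uk n δ Γ) (l : ℕ) (q : Finset E) (i : Fin k) :
    ∑ x ∈ q, c x i ≤ zBSk n δ Γ e l q i := by
  obtain ⟨hb, hcard⟩ := hc
  have hd := dbarK_nonneg (e := e) hδ l i
  have hpt : ∀ x ∈ q, c x i ≤ n x i + (if n x i < c x i then dbarK δ e l i else 0) +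
      (if (e.symm x : ℕ) + 1 ≤ l then δ x i - dbarK δ e l i else 0) := by
    intro x _
    have h2 := (hb x i).2
    split_ifs with h3 h4 h4
    · linarith
    · have := le_dbarK_of_lt hsort (not_le.mp h4) i
      linarith
    · have := dbarK_le_of_le hδ hsort h4 i
      linarith
    · linarith
  refine (Finset.sum_le_sum hpt).trans ?_
  rw [Finset.sum_add_distrib, Finset.sum_add_distrib, ← Finset.sum_filter, ← Finset.sum_filter,
    Finset.sum_const, nsmul_eq_mul]
  have hle : #{x ∈ q | n x i < c x i} ≤ Γ i :=
    (Finset.card_le_card (Finset.filter_subset_filter _ (Finset.subset_univ q))).trans (hcard i)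
  unfold zBSk
  gcongr

lemma Uk_nonempty (hδ : ∀ x i, 0 ≤ δ x i) : (Uk n δ Γ).Nonempty :=
  ⟨n, fun x i => ⟨le_rfl, by linarith [hδ x i]⟩, by simp⟩

lemma zRCk_le_zBSk (hδ : ∀ x i, 0 ≤ δ x i)
    (hsort : ∀ i : Fin k, ∀ a b : Fin (Fintype.card E), a ≤ b → δ (e b) i ≤ δ (e a) i)
    (l : ℕ) (q : Finset E) (i : Fin k) :
    zRCk n δ Γ q i ≤ zBSk n δ Γ e l q i := by
  obtain ⟨c, hc⟩ := Uk_nonempty (n := n) (Γ := Γ) hδ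
  refine csSup_le ⟨_, c, hc, rfl⟩ ?_
  rintro _ ⟨c, hc, rfl⟩
  exact sum_le_zBSk hδ hsort hc l q i

lemma sum_le_zRCk (e : Fin (Fintype.card E) ≃ E) (hδ : ∀ x i, 0 ≤ δ x i)
    (hsort : ∀ i : Fin k, ∀ a b : Fin (Fintype.card E), a ≤ b → δ (e b) i ≤ δ (e a) i)
    {c : E → Fin k → ℝ} (hc : c ∈ Uk n δ Γ) (q : Finset E) (i : Fin k) :
    ∑ x ∈ q, c x i ≤ zRCk n δ Γ q i := by
  refine le_csSup ⟨zBSk n δ Γ e 0 q i, ?_⟩ ⟨c, hc, rfl⟩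
  rintro _ ⟨c, hc, rfl⟩
  exact sum_le_zBSk hδ hsort hc 0 q i

/-- A prefix of the enumeration contains exactly `g` elements of `q`, or the whole enumeration
contains at most `g` of them. -/
lemma exists_prefix_card (e : Fin (Fintype.card E) ≃ E) {g : ℕ} (hg : 1 ≤ g) (q : Finset E) :
    ∃ l, 1 ≤ l ∧ l ≤ Fintype.card E + 1 ∧ #{x ∈ q | (e.symm x : ℕ) + 1 ≤ l} ≤ g ∧
      (#{x ∈ q | (e.symm x : ℕ) + 1 ≤ l} = g ∨ l = Fintype.card E + 1) := by
  set f : ℕ → ℕ := fun l => #{x ∈ q | (e.symm x : ℕ) + 1 ≤ l} with hf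
  have hstep : ∀ l, f (l + 1) ≤ f l + 1 := by
    intro l
    have hsub : {x ∈ q | (e.symm x : ℕ) + 1 ≤ l + 1} ⊆
        {x ∈ q | (e.symm x : ℕ) + 1 ≤ l} ∪ {x ∈ q | (e.symm x : ℕ) = l} := by
      intro x hx
      simp only [Finset.mem_union, Finset.mem_filter] at hx ⊢
      have := hx.2
      rcases Nat.lt_or_ge (e.symm x : ℕ) l with h | h
      · exact Or.inl ⟨hx.1, h⟩
      · exact Or.inr ⟨hx.1, by omega⟩
    have hone : #{x ∈ q | (e.symm x : ℕ) = l} ≤ 1 := by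
      rw [Finset.card_le_one]
      intro a ha b hb
      simp only [Finset.mem_filter] at ha hb
      exact e.symm.injective (Fin.ext (ha.2.trans hb.2.symm))
    have h1 := (Finset.card_le_card hsub).trans (Finset.card_union_le _ _)
    simp only [hf]
    omega
  have hf0 : f 0 = 0 := by simp [hf]
  have hf1 : f 1 ≤ g := by
    have := hstep 0
    simp only [zero_add] at this
    omega
  have hle := Nat.findGreatest_le (P := fun l => f l ≤ g) (Fintype.card E + 1)
  have hge : 1 ≤ Nat.findGreatest (fun l => f l ≤ g) (Fintype.card E + 1) :=
    Nat.le_findGreatest (by omega) hf1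
  have hspec : f (Nat.findGreatest (fun l => f l ≤ g) (Fintype.card E + 1)) ≤ g :=
    Nat.findGreatest_spec (P := fun l => f l ≤ g) (m := 1) (by omega) hf1
  refine ⟨_, hge, hle, hspec, ?_⟩
  by_contra! hne
  obtain ⟨hne1, hne2⟩ := hne
  have hnot := Nat.findGreatest_is_greatest (P := fun l => f l ≤ g) (Nat.lt_succ_self _)
    (Nat.succ_le_of_lt (lt_of_le_of_ne hle hne2))
  have := hstep (Nat.findGreatest (fun l => f l ≤ g) (Fintype.card E + 1))
  have hgt : g < f (Nat.findGreatest (fun l => f l ≤ g) (Fintype.card E + 1) + 1) :=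
    not_le.mp hnot
  exact hne1 (le_antisymm hspec (by change g ≤ f _; omega))

/-- Some bottleneck-sum objective attains the worst-case cost of `q` in all objectives at once. -/
lemma exists_zBSk_eq_zRCk (hk : 0 < k) (hδ : ∀ x i, 0 ≤ δ x i) (hΓ1 : ∀ i, 1 ≤ Γ i)
    (hΓeq : ∀ i j, Γ i = Γ j)
    (hsort : ∀ i : Fin k, ∀ a b : Fin (Fintype.card E), a ≤ b → δ (e b) i ≤ δ (e a) i)
    (q : Finset E) :
    ∃ l, 1 ≤ l ∧ l ≤ Fintype.card E + 1 ∧ zBSk n δ Γ e l q = zRCk n δ Γ q := by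
  obtain ⟨l, hl1, hl2, hcard, hor⟩ := exists_prefix_card e (hΓ1 ⟨0, hk⟩) q
  refine ⟨l, hl1, hl2, funext fun i => le_antisymm ?_ (zRCk_le_zBSk hδ hsort l q i)⟩
  rw [hΓeq _ i] at hcard hor
  set T := {x ∈ q | (e.symm x : ℕ) + 1 ≤ l} with hT
  have hc : (fun x j => n x j + if x ∈ T then δ x j else 0) ∈ Uk n δ Γ := by
    refine ⟨fun x j => ?_, fun j => ?_⟩
    · have := hδ x j
      dsimp only
      split_ifs <;> constructor <;> linarith
    · rw [hΓeq j i]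
      refine (Finset.card_le_card fun x hx => ?_).trans hcard
      by_contra hxT
      simp [hxT] at hx
  refine le_trans (le_of_eq ?_) (sum_le_zRCk e hδ hsort hc q i)
  have hqT : {x ∈ q | x ∈ T} = T := by
    ext x
    simp [hT]
  rw [Finset.sum_add_distrib, ← Finset.sum_filter, hqT]
  unfold zBSk
  rw [← hT, Finset.sum_sub_distrib, Finset.sum_const, nsmul_eq_mul]
  rcases hor with h | h
  · rw [h]
    ring
  · rw [h, dbarK_card_add_one]
    ring

end WorstCase

/-- If every feasible solution is weakly dominated by a member of `Z ⊆ Q`, the nondominated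
members of `Z` form a complete set of efficient solutions. -/
lemma completeEff_of_forall_exists_le {E ι : Type*} [Finite E] {Q Z : Set (Finset E)}
    {f : Finset E → ι → ℝ} (hZQ : Z ⊆ Q) (hle : ∀ q ∈ Q, ∃ z ∈ Z, f z ≤ f q) :
    CompleteEff Q f {q | q ∈ Z ∧ ¬ ∃ q', q' ∈ Z ∧ Dominates (f q') (f q)} := by
  refine ⟨fun q hq => hZQ hq.1, ?_, ?_⟩
  · rintro q ⟨hqZ, hq⟩
    refine ⟨hZQ hqZ, fun q' hq' hdom => hq ?_⟩
    obtain ⟨z, hz, hzq'⟩ := hle q' hq'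
    refine ⟨z, hz, fun j => (hzq' j).trans (hdom.1 j), fun heq => hdom.2 ?_⟩
    exact le_antisymm hdom.1 (heq ▸ hzq')
  · intro q hq
    obtain ⟨z, ⟨hz, hzq⟩, hmin⟩ :=
      (Set.toFinite {z | z ∈ Z ∧ f z ≤ f q}).exists_minimalFor f _ (hle q hq)
    refine ⟨z, ⟨hz, ?_⟩, ?_⟩
    · rintro ⟨z', hz', hdom⟩
      exact hdom.2 (le_antisymm hdom.1 (hmin ⟨hz', le_trans hdom.1 hzq⟩ hdom.1))
    · by_cases h : f z = f q
      · exact Or.inr h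
      · exact Or.inl ⟨hzq, h⟩

/-- Under objective independent element order, if `Z^l` is a complete set of efficient
solutions of `min_{q∈Q} zBS^l(q)` for each `l ∈ {1,…,m+1}` and `Z` is their union, then the
members of `Z` whose worst-case vector is dominated by no member of `Z` form a complete
set of robust efficient solutions (a complete set of efficient solutions for `zRC`). -/
theorem stmt9 {E : Type*} [Fintype E] [DecidableEq E] [Nonempty E] {k : ℕ} (hk : 0 < k)
    (Q : Set (Finset E)) (hQ : Q.Nonempty)
    (n δ : E → Fin k → ℝ) (hδ : ∀ x i, 0 ≤ δ x i)
    (Γ : Fin k → ℕ) (hΓ1 : ∀ i, 1 ≤ Γ i) (hΓ2 : ∀ i, Γ i ≤ Fintype.card E)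
    (hΓeq : ∀ i j, Γ i = Γ j)
    (e : Fin (Fintype.card E) ≃ E)
    (hsort : ∀ i : Fin k, ∀ a b : Fin (Fintype.card E), a ≤ b → δ (e b) i ≤ δ (e a) i)
    (Z : ℕ → Set (Finset E))
    (hZ : ∀ l, 1 ≤ l → l ≤ Fintype.card E + 1 → CompleteEff Q (zBSk n δ Γ e l) (Z l)) :
    CompleteEff Q (zRCk n δ Γ)
      {q | (∃ l, 1 ≤ l ∧ l ≤ Fintype.card E + 1 ∧ q ∈ Z l) ∧
        ¬ ∃ q', (∃ l, 1 ≤ l ∧ l ≤ Fintype.card E + 1 ∧ q' ∈ Z l) ∧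
          Dominates (zRCk n δ Γ q') (zRCk n δ Γ q)} := by
  refine completeEff_of_forall_exists_le
    (Z := {q | ∃ l, 1 ≤ l ∧ l ≤ Fintype.card E + 1 ∧ q ∈ Z l}) ?_ ?_
  · rintro q ⟨l, hl1, hl2, hq⟩
    exact (hZ l hl1 hl2).1 hq
  · intro q hq
    obtain ⟨l, hl1, hl2, heq⟩ := exists_zBSk_eq_zRCk (n := n) hk hδ hΓ1 hΓeq hsort q
    obtain ⟨z, hz, hzq⟩ := (hZ l hl1 hl2).2.2 q hq
    refine ⟨z, ⟨l, hl1, hl2, hz⟩, fun i => (zRCk_le_zBSk hδ hsort l z i).trans ?_⟩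
    rw [← heq]
    rcases hzq with h | h
    · exact h.1 i
    · exact (congrFun h i).le
end

section
/- In the general multi-objective setting, for each l ∈ {1, …, m+1}^k let Z^l ⊆ Q be a complete set of efficient solutions for the multi-objective problem min_{q∈Q} zBS^l(q), and set Z = ∪_{l ∈ {1,…,m+1}^k} Z^l. Then the set S = {q ∈ Z : there is no q′ ∈ Z such that zRC(q′) dominates zRC(q)} is a complete set of robust efficient solutions, i.e., a complete set of efficient solutions for zRC. -/
open Finset

/-- `δ̄^i_l` for `l ∈ {1,…,m}` (1-based), and `δ̄^i_{m+1} = 0`, where for each objective `i`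
the enumeration `e i : Fin m ≃ E` lists the elements in order of decreasing `δ_{·,i}`. -/
noncomputable def dbarG {E : Type*} [Fintype E] {k : ℕ} (δ : E → Fin k → ℝ)
    (e : Fin k → (Fin (Fintype.card E) ≃ E)) (i : Fin k) (l : ℕ) : ℝ :=
  if h : l - 1 < Fintype.card E then δ ((e i) ⟨l - 1, h⟩) i else 0

/-- The general multi-objective subproblem objective
`zBS^l_i(q) = ∑_{e∈q} n e i + Γ_i·δ̄^i_{l_i} + ∑_{e ∈ q ∩ E^i_{l_i}} (δ_{e,i} − δ̄^i_{l_i})`,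
where `E^i_{l_i}` consists of the elements whose 1-based index in the `i`-th enumeration
is at most `l_i`. -/
noncomputable def zBSg {E : Type*} [Fintype E] [DecidableEq E] {k : ℕ}
    (n δ : E → Fin k → ℝ) (Γ : Fin k → ℕ) (e : Fin k → (Fin (Fintype.card E) ≃ E))
    (l : Fin k → ℕ) (q : Finset E) : Fin k → ℝ :=
  fun i => (∑ x ∈ q, n x i) + Γ i * dbarG δ e i (l i) +
    ∑ x ∈ q.filter (fun x => (((e i).symm x : ℕ) + 1 ≤ l i)), (δ x i - dbarG δ e i (l i))

theorem dominates_iff_lt {ι : Type*} {y y' : ι → ℝ} : Dominates y y' ↔ y < y' :=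
  (lt_iff_le_and_ne (a := y) (b := y')).symm

section

variable {E : Type*} [Fintype E] {k : ℕ} {δ : E → Fin k → ℝ}
  {e : Fin k → (Fin (Fintype.card E) ≃ E)}

theorem dbarG_nonneg (hδ : ∀ x i, 0 ≤ δ x i) (i : Fin k) (l : ℕ) : 0 ≤ dbarG δ e i l := by
  unfold dbarG
  split_ifs
  exacts [hδ _ _, le_rfl]

theorem dbarG_card_add_one (i : Fin k) : dbarG δ e i (Fintype.card E + 1) = 0 := by
  simp [dbarG]

theorem dbarG_le_of_index_le (hδ : ∀ x i, 0 ≤ δ x i)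
    (hsort : ∀ i : Fin k, ∀ a b : Fin (Fintype.card E), a ≤ b → δ ((e i) b) i ≤ δ ((e i) a) i)
    {i : Fin k} {l : ℕ} {x : E} (hx : ((e i).symm x : ℕ) + 1 ≤ l) :
    dbarG δ e i l ≤ δ x i := by
  unfold dbarG
  split_ifs with h
  · simpa using hsort i ((e i).symm x) ⟨l - 1, h⟩ (Fin.le_def.2 (by simp only; omega))
  · exact hδ _ _

theorem le_dbarG_of_lt_index
    (hsort : ∀ i : Fin k, ∀ a b : Fin (Fintype.card E), a ≤ b → δ ((e i) b) i ≤ δ ((e i) a) i)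
    {i : Fin k} {l : ℕ} {x : E} (hx : ¬ ((e i).symm x : ℕ) + 1 ≤ l) :
    δ x i ≤ dbarG δ e i l := by
  have hlt := ((e i).symm x).isLt
  have h : l - 1 < Fintype.card E := by omega
  rw [dbarG, dif_pos h]
  simpa using hsort i ⟨l - 1, h⟩ ((e i).symm x) (Fin.le_def.2 (by simp only; omega))

variable [DecidableEq E] {n : E → Fin k → ℝ} {Γ : Fin k → ℕ}

/-- Every scenario cost of `q` is at most the objective value of each subproblem. -/
theorem sum_le_zBSg (hδ : ∀ x i, 0 ≤ δ x i)
    (hsort : ∀ i : Fin k, ∀ a b : Fin (Fintype.card E), a ≤ b → δ ((e i) b) i ≤ δ ((e i) a) i)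
    (l : Fin k → ℕ) (q : Finset E) (i : Fin k) {c : E → Fin k → ℝ} (hc : c ∈ Uk n δ Γ) :
    ∑ x ∈ q, c x i ≤ zBSg n δ Γ e l q i := by
  obtain ⟨hbd, hcard⟩ := hc
  set d := dbarG δ e i (l i) with hd
  have hd0 : 0 ≤ d := dbarG_nonneg hδ i (l i)
  have hpoint : ∀ x ∈ q, c x i ≤ n x i + (if n x i < c x i then d else 0) +
      (if ((e i).symm x : ℕ) + 1 ≤ l i then δ x i - d else 0) := by
    intro x _
    have hx := hbd x i
    by_cases h2 : ((e i).symm x : ℕ) + 1 ≤ l i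
    · have := dbarG_le_of_index_le hδ hsort h2
      split_ifs <;> linarith
    · have := le_dbarG_of_lt_index hsort h2
      split_ifs <;> linarith
  have hcount : ∑ x ∈ q, (if n x i < c x i then d else 0) ≤ Γ i * d := by
    rw [← Finset.sum_filter, Finset.sum_const, nsmul_eq_mul]
    refine mul_le_mul_of_nonneg_right ?_ hd0
    exact_mod_cast (Finset.card_le_card
      (Finset.filter_subset_filter _ (Finset.subset_univ q))).trans (hcard i)
  have := Finset.sum_le_sum hpoint
  rw [Finset.sum_add_distrib, Finset.sum_add_distrib] at this
  rw [zBSg, Finset.sum_filter]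
  linarith

/-- The nominal costs belong to the uncertainty set. -/
theorem nominal_mem_Uk (hδ : ∀ x i, 0 ≤ δ x i) : n ∈ Uk n δ Γ :=
  ⟨fun x i => ⟨le_rfl, le_add_of_nonneg_right (hδ x i)⟩, fun i => by simp⟩

theorem zRCk_le_zBSg (hδ : ∀ x i, 0 ≤ δ x i)
    (hsort : ∀ i : Fin k, ∀ a b : Fin (Fintype.card E), a ≤ b → δ ((e i) b) i ≤ δ ((e i) a) i)
    (l : Fin k → ℕ) (q : Finset E) : zRCk n δ Γ q ≤ zBSg n δ Γ e l q := by
  intro i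
  refine csSup_le ⟨_, n, nominal_mem_Uk hδ, rfl⟩ ?_
  rintro _ ⟨c, hc, rfl⟩
  exact sum_le_zBSg hδ hsort l q i hc

/-- Each objective has a cutoff whose initial segment meets `q` in exactly `Γ i` elements, or in
at most `Γ i` elements when the cutoff is the last one. -/
theorem exists_cutoff (e : Fin k → (Fin (Fintype.card E) ≃ E)) (q : Finset E) (i : Fin k)
    (hΓ : 1 ≤ Γ i) :
    ∃ l, 1 ≤ l ∧ l ≤ Fintype.card E + 1 ∧
      (q.filter fun x => ((e i).symm x : ℕ) + 1 ≤ l).card ≤ Γ i ∧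
      ((q.filter fun x => ((e i).symm x : ℕ) + 1 ≤ l).card = Γ i ∨
        l = Fintype.card E + 1) := by
  classical
  have hex : ∃ l, Γ i ≤ (q.filter fun x => ((e i).symm x : ℕ) + 1 ≤ l).card ∨
      l = Fintype.card E + 1 := ⟨_, Or.inr rfl⟩
  obtain ⟨l, hl, hmin⟩ : ∃ l, (Γ i ≤ (q.filter fun x => ((e i).symm x : ℕ) + 1 ≤ l).card ∨
      l = Fintype.card E + 1) ∧ ∀ j < l, ¬ (Γ i ≤
        (q.filter fun x => ((e i).symm x : ℕ) + 1 ≤ j).card ∨ j = Fintype.card E + 1) :=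
    ⟨Nat.find hex, Nat.find_spec hex, fun _ => Nat.find_min hex⟩
  have hle : l ≤ Fintype.card E + 1 := by
    by_contra h
    exact hmin _ (not_le.1 h) (Or.inr rfl)
  obtain _ | j := l
  · simp at hl
    omega
  have hj := hmin j (Nat.lt_succ_self j)
  have hsub : (q.filter fun x => ((e i).symm x : ℕ) + 1 ≤ j + 1) \
      (q.filter fun x => ((e i).symm x : ℕ) + 1 ≤ j) ⊆
        Finset.univ.filter fun x => ((e i).symm x : ℕ) = j := by
    intro x
    simp only [Finset.mem_sdiff, Finset.mem_filter, Finset.mem_univ, true_and]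
    rintro ⟨⟨hx, h⟩, h'⟩
    by_contra hne
    exact h' ⟨hx, by omega⟩
  have hone : (Finset.univ.filter fun x => ((e i).symm x : ℕ) = j).card ≤ 1 := by
    refine Finset.card_le_one.2 fun a ha b hb => ?_
    simp only [Finset.mem_filter, Finset.mem_univ, true_and] at ha hb
    exact (e i).symm.injective (Fin.ext (ha.trans hb.symm))
  have hstep := Finset.card_le_card_sdiff_add_card
    (t := q.filter fun x => ((e i).symm x : ℕ) + 1 ≤ j)
    (s := q.filter fun x => ((e i).symm x : ℕ) + 1 ≤ j + 1)
  have hdiff := (Finset.card_le_card hsub).trans hone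
  push Not at hj
  refine ⟨j + 1, Nat.succ_pos j, hle, by omega, ?_⟩
  rcases hl with h | h
  · exact Or.inl (by omega)
  · exact Or.inr h

/-- Raising the costs to their upper bounds on a set `T i` of at most `Γ i` elements for each
objective `i` gives a member of the uncertainty set. -/
theorem raise_mem_Uk (hδ : ∀ x i, 0 ≤ δ x i) {T : Fin k → Finset E}
    (hT : ∀ i, (T i).card ≤ Γ i) :
    (fun x i => n x i + if x ∈ T i then δ x i else 0) ∈ Uk n δ Γ := by
  refine ⟨fun x i => ?_, fun i => (Finset.card_le_card fun x hx => ?_).trans (hT i)⟩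
  · have := hδ x i
    dsimp only
    split_ifs <;> constructor <;> linarith
  · by_contra h
    simp [h] at hx

theorem exists_zBSg_le_zRCk (hδ : ∀ x i, 0 ≤ δ x i) (hΓ : ∀ i, 1 ≤ Γ i)
    (hsort : ∀ i : Fin k, ∀ a b : Fin (Fintype.card E), a ≤ b → δ ((e i) b) i ≤ δ ((e i) a) i)
    (q : Finset E) :
    ∃ l : Fin k → ℕ, (∀ i, 1 ≤ l i ∧ l i ≤ Fintype.card E + 1) ∧
      zBSg n δ Γ e l q ≤ zRCk n δ Γ q := by
  choose l h1 h2 hcard hcut using fun i => exists_cutoff e q i (hΓ i)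
  refine ⟨l, fun i => ⟨h1 i, h2 i⟩, fun i => ?_⟩
  refine le_csSup ⟨zBSg n δ Γ e l q i, ?_⟩ ⟨_, raise_mem_Uk hδ hcard, ?_⟩
  · rintro _ ⟨c, hc, rfl⟩
    exact sum_le_zBSg hδ hsort l q i hc
  · rw [Finset.sum_add_distrib, ← Finset.sum_filter, Finset.filter_mem_eq_inter,
      Finset.inter_eq_right.2 (Finset.filter_subset _ _), zBSg, Finset.sum_sub_distrib,
      Finset.sum_const, nsmul_eq_mul]
    rcases hcut i with h | h
    · rw [h]
      ring
    · rw [h, dbarG_card_add_one]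
      ring

end

/-- If the values of `Z ⊆ Q` lie weakly below those of `Q`, then the members of `Z` that are
nondominated within `Z` form a complete set of efficient solutions. -/
theorem completeEff_nondominated {E ι : Type*} [Finite E] {Q Z : Set (Finset E)}
    {f : Finset E → ι → ℝ} (hZQ : Z ⊆ Q) (hcover : ∀ q ∈ Q, ∃ z ∈ Z, f z ≤ f q) :
    CompleteEff Q f {q | q ∈ Z ∧ ¬ ∃ q', q' ∈ Z ∧ Dominates (f q') (f q)} := by
  refine ⟨fun q hq => hZQ hq.1, fun q hq => ⟨hZQ hq.1, fun q' hq' hdom => ?_⟩, fun q hq => ?_⟩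
  · obtain ⟨z, hz, hzq'⟩ := hcover q' hq'
    exact hq.2 ⟨z, hz, dominates_iff_lt.2 (hzq'.trans_lt (dominates_iff_lt.1 hdom))⟩
  · obtain ⟨z, ⟨hz, hzq⟩, hmin⟩ :=
      (Set.toFinite {z | z ∈ Z ∧ f z ≤ f q}).exists_minimalFor f _ (hcover q hq)
    refine ⟨z, ⟨hz, ?_⟩, ?_⟩
    · rintro ⟨z', hz', hdom⟩
      have hlt := dominates_iff_lt.1 hdom
      exact hlt.not_ge (hmin ⟨hz', hlt.le.trans hzq⟩ hlt.le)
    · rw [dominates_iff_lt]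
      exact hzq.lt_or_eq

/-- In the general multi-objective setting: if `Z^l` is a complete set of efficient solutions
of `min_{q∈Q} zBS^l(q)` for each `l ∈ {1,…,m+1}^k` and `Z` is their union, then the members
of `Z` whose worst-case vector is dominated by no member of `Z` form a complete set of
robust efficient solutions (a complete set of efficient solutions for `zRC`). -/
theorem stmt13 {E : Type*} [Fintype E] [DecidableEq E] [Nonempty E] {k : ℕ} (hk : 0 < k)
    (Q : Set (Finset E)) (hQ : Q.Nonempty)
    (n δ : E → Fin k → ℝ) (hδ : ∀ x i, 0 ≤ δ x i)
    (Γ : Fin k → ℕ) (hΓ1 : ∀ i, 1 ≤ Γ i) (hΓ2 : ∀ i, Γ i ≤ Fintype.card E)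
    (e : Fin k → (Fin (Fintype.card E) ≃ E))
    (hsort : ∀ i : Fin k, ∀ a b : Fin (Fintype.card E), a ≤ b → δ ((e i) b) i ≤ δ ((e i) a) i)
    (Z : (Fin k → ℕ) → Set (Finset E))
    (hZ : ∀ l : Fin k → ℕ, (∀ i, 1 ≤ l i ∧ l i ≤ Fintype.card E + 1) →
      CompleteEff Q (zBSg n δ Γ e l) (Z l)) :
    CompleteEff Q (zRCk n δ Γ)
      {q | (∃ l : Fin k → ℕ, (∀ i, 1 ≤ l i ∧ l i ≤ Fintype.card E + 1) ∧ q ∈ Z l) ∧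
        ¬ ∃ q', (∃ l : Fin k → ℕ, (∀ i, 1 ≤ l i ∧ l i ≤ Fintype.card E + 1) ∧ q' ∈ Z l) ∧
          Dominates (zRCk n δ Γ q') (zRCk n δ Γ q)} := by
  refine completeEff_nondominated
    (Z := {q | ∃ l : Fin k → ℕ, (∀ i, 1 ≤ l i ∧ l i ≤ Fintype.card E + 1) ∧ q ∈ Z l}) ?_ ?_
  · rintro q ⟨l, hl, hq⟩
    exact (hZ l hl).1 hq
  · intro q hq
    obtain ⟨l, hl, hle⟩ := exists_zBSg_le_zRCk hδ hΓ1 hsort q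
    obtain ⟨z, hz, h⟩ := (hZ l hl).2.2 q hq
    have hzq : zBSg n δ Γ e l z ≤ zBSg n δ Γ e l q :=
      h.elim (fun h => (dominates_iff_lt.1 h).le) le_of_eq
    exact ⟨z, ⟨l, hl, hz⟩, (zRCk_le_zBSg hδ hsort l z).trans (hzq.trans hle)⟩
end
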